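/- arXiv:1001.1901 — 2 statements merged into one kernel-verified Lean document; each statement's English description precedes it below -/
import Mathlib

section
/- Let ξ be a cost-sharing scheme, let L ⊆ U ⊆ A, and suppose that ξ satisfies the three conditions of Fence Monotonicity at every pair (L′,U′) with L′ ⊆ U′ ⊆ A and |U′∖L′| < |U∖L|. Then for every j ∈ L there exists a set S_j with L ⊆ S_j ⊆ U such that ξ(i,S_j) = ξ*(i,L,U) for all i ∈ S_j∖L and ξ(j,S_j) = ξ*(j,L,U). -/
open Finset

variable {n : ℕ}

/-- A cost-sharing scheme: nonnegative payments, and zero payment for non-serviced players. -/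
def IsCostSharingScheme (ξ : Fin n → Finset (Fin n) → ℝ) : Prop :=
  (∀ i S, 0 ≤ ξ i S) ∧ (∀ i S, i ∉ S → ξ i S = 0)

/-- The minimum payment ξ*(i,L,U) = min{ ξ(i,S) : L ⊆ S ⊆ U, i ∈ S }. -/
noncomputable def xiStar (ξ : Fin n → Finset (Fin n) → ℝ) (L U : Finset (Fin n)) (i : Fin n) : ℝ :=
  sInf {x : ℝ | ∃ S : Finset (Fin n), L ⊆ S ∧ S ⊆ U ∧ i ∈ S ∧ ξ i S = x}

/-- Fence Monotonicity at a pair L ⊆ U. -/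
def FenceMonoAt (ξ : Fin n → Finset (Fin n) → ℝ) (L U : Finset (Fin n)) : Prop :=
  (∃ S : Finset (Fin n), L ⊆ S ∧ S ⊆ U ∧ ∀ i ∈ S, ξ i S = xiStar ξ L U i) ∧
  (∀ i ∈ U \ L, ∃ S : Finset (Fin n), L ⊆ S ∧ S ⊆ U ∧ i ∈ S ∧
    ∀ j ∈ S \ L, ξ j S = xiStar ξ L U j) ∧
  (∀ C : Finset (Fin n), C ⊂ U → (∃ i ∈ C, ξ i C < xiStar ξ L U i) →
    ∃ T : Finset (Fin n), T.Nonempty ∧ T ⊆ L \ C ∧ ∀ j ∈ T, ξ j (C ∪ T) = xiStar ξ L U j)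

/-- Fence Monotonicity: the three conditions hold at every pair L ⊆ U. -/
def FenceMonotone (ξ : Fin n → Finset (Fin n) → ℝ) : Prop :=
  ∀ L U : Finset (Fin n), L ⊆ U → FenceMonoAt ξ L U

/-- Voluntary participation: a serviced player is never charged more than her bid. -/
def VP (ξ : Fin n → Finset (Fin n) → ℝ) (O : (Fin n → ℝ) → Finset (Fin n)) : Prop :=
  ∀ b : Fin n → ℝ, ∀ i ∈ O b, ξ i (O b) ≤ b i

/-- Consumer sovereignty: each player has a bid that guarantees service. -/
def CS (O : (Fin n → ℝ) → Finset (Fin n)) : Prop :=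
  ∀ i : Fin n, ∃ bstar : ℝ, ∀ b : Fin n → ℝ, b i = bstar → i ∈ O b

/-- Utility of player `i` with true value `v i` at bid vector `b`. -/
noncomputable def utility (ξ : Fin n → Finset (Fin n) → ℝ) (O : (Fin n → ℝ) → Finset (Fin n))
    (v b : Fin n → ℝ) (i : Fin n) : ℝ :=
  if i ∈ O b then v i - ξ i (O b) else 0

/-- Group-strategyproofness. -/
def GSP (ξ : Fin n → Finset (Fin n) → ℝ) (O : (Fin n → ℝ) → Finset (Fin n)) : Prop :=
  ∀ v v' : Fin n → ℝ,
    (∃ i : Fin n, v i ≠ v' i ∧ utility ξ O v v' i < utility ξ O v v i) ∨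
    (∀ i : Fin n, utility ξ O v v' i = utility ξ O v v i)

/-- The pair (L,U) is stable at the bid vector b. -/
def StablePair (ξ : Fin n → Finset (Fin n) → ℝ) (b : Fin n → ℝ) (L U : Finset (Fin n)) : Prop :=
  L ⊆ U ∧
  (∀ i ∈ L, xiStar ξ L U i < b i) ∧
  (∀ i ∈ U \ L, b i = xiStar ξ L U i) ∧
  (∀ R : Finset (Fin n), R ⊆ Uᶜ → R.Nonempty → ∃ i ∈ R, b i < xiStar ξ L (U ∪ R) i)

/-- Player i harms player j (at the pair L ⊆ U). -/
def Harms (ξ : Fin n → Finset (Fin n) → ℝ) (L U : Finset (Fin n)) (i j : Fin n) : Prop :=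
  j ≠ i ∧ xiStar ξ L U j < xiStar ξ (insert i L) U j

lemma finite_setOf_payments (ξ : Fin n → Finset (Fin n) → ℝ) (L U : Finset (Fin n)) (i : Fin n) :
    {x : ℝ | ∃ S : Finset (Fin n), L ⊆ S ∧ S ⊆ U ∧ i ∈ S ∧ ξ i S = x}.Finite :=
  (Set.finite_range (ξ i)).subset (by rintro x ⟨S, -, -, -, rfl⟩; exact ⟨S, rfl⟩)

lemma xiStar_le (ξ : Fin n → Finset (Fin n) → ℝ) {L U S : Finset (Fin n)} {i : Fin n}
    (hLS : L ⊆ S) (hSU : S ⊆ U) (hi : i ∈ S) : xiStar ξ L U i ≤ ξ i S :=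
  csInf_le (finite_setOf_payments ξ L U i).bddBelow ⟨S, hLS, hSU, hi, rfl⟩

lemma exists_eq_xiStar (ξ : Fin n → Finset (Fin n) → ℝ) {L U : Finset (Fin n)} {i : Fin n}
    (hLU : L ⊆ U) (hi : i ∈ U) :
    ∃ S : Finset (Fin n), L ⊆ S ∧ S ⊆ U ∧ i ∈ S ∧ ξ i S = xiStar ξ L U i :=
  have hne : {x : ℝ | ∃ S : Finset (Fin n), L ⊆ S ∧ S ⊆ U ∧ i ∈ S ∧ ξ i S = x}.Nonempty :=
    ⟨ξ i U, U, hLU, subset_rfl, hi, rfl⟩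
  hne.csInf_mem (finite_setOf_payments ξ L U i)

lemma xiStar_insert_self (ξ : Fin n → Finset (Fin n) → ℝ) (L U : Finset (Fin n)) (i : Fin n) :
    xiStar ξ (insert i L) U i = xiStar ξ L U i := by
  unfold xiStar
  congr 1
  ext x
  simp only [Set.mem_ofPred_eq, insert_subset_iff]
  grind

lemma xiStar_le_xiStar_insert (ξ : Fin n → Finset (Fin n) → ℝ) {L U : Finset (Fin n)}
    {i k : Fin n} (hLU : L ⊆ U) (hi : i ∈ U) (hk : k ∈ U) :
    xiStar ξ L U k ≤ xiStar ξ (insert i L) U k := by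
  obtain ⟨S, hLS, hSU, hkS, hS⟩ := exists_eq_xiStar ξ (insert_subset hi hLU) hk
  exact hS ▸ xiStar_le ξ ((subset_insert i L).trans hLS) hSU hkS

lemma xiStar_insert_of_not_harms (ξ : Fin n → Finset (Fin n) → ℝ) {L U : Finset (Fin n)}
    {i k : Fin n} (hLU : L ⊆ U) (hi : i ∈ U) (hk : k ∈ U) (h : ¬ Harms ξ L U i k) :
    xiStar ξ (insert i L) U k = xiStar ξ L U k := by
  rcases eq_or_ne k i with rfl | hki
  · exact xiStar_insert_self ξ L U k
  · exact le_antisymm (not_lt.1 fun hlt => h ⟨hki, hlt⟩) (xiStar_le_xiStar_insert ξ hLU hi hk)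

lemma Harms.notMem {ξ : Fin n → Finset (Fin n) → ℝ} {L U S : Finset (Fin n)} {i k : Fin n}
    (h : Harms ξ L U i k) (hLS : L ⊆ S) (hSU : S ⊆ U) (hk : k ∈ S)
    (hS : ξ k S = xiStar ξ L U k) : i ∉ S := fun hi =>
  absurd (xiStar_le ξ (insert_subset hi hLS) hSU hk) (not_le.2 (hS ▸ h.2))

lemma Harms.notMem_of_harms {ξ : Fin n → Finset (Fin n) → ℝ} {L U : Finset (Fin n)} {i k j : Fin n}
    (hk : k ∈ U) (hFM : FenceMonoAt ξ (insert k L) U)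
    (hik : Harms ξ L U i k) (hkj : Harms ξ L U k j) {C : Finset (Fin n)} (hLC : L ⊆ C)
    (hCU : C ⊆ U) (hj : j ∈ C) (hC : ξ j C = xiStar ξ L U j) : i ∉ C := by
  have hkC : k ∉ C := hkj.notMem hLC hCU hj hC
  obtain ⟨T, ⟨t, ht⟩, hTsub, hT⟩ := hFM.2.2 C
    (hCU.ssubset_of_ne fun h => hkC (h ▸ hk)) ⟨j, hj, hC ▸ hkj.2⟩
  have hTk : T = {k} := by
    ext x
    have h_only : ∀ y ∈ T, y = k := fun y hy => by
      have := hTsub hy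
      grind
    constructor
    · exact fun hx => mem_singleton.2 (h_only x hx)
    · intro hx
      rw [mem_singleton.1 hx, ← h_only t ht]
      exact ht
  subst hTk
  have hpay := hT k (mem_singleton_self k)
  rw [xiStar_insert_self] at hpay
  have := hik.notMem (hLC.trans subset_union_left)
    (union_subset hCU (singleton_subset_iff.2 hk)) (by simp) hpay
  exact fun hi => this (mem_union_left _ hi)

lemma Harms.trans {ξ : Fin n → Finset (Fin n) → ℝ} {L U : Finset (Fin n)} {i k j : Fin n}
    (hLU : L ⊆ U) (hi : i ∈ U) (hk : k ∈ U) (hj : j ∈ U)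
    (hFM : FenceMonoAt ξ (insert k L) U)
    (hik : Harms ξ L U i k) (hkj : Harms ξ L U k j) : Harms ξ L U i j := by
  by_contra h
  obtain ⟨C, hLC, hCU, hjC, hC⟩ := exists_eq_xiStar ξ (insert_subset hi hLU) hj
  rw [xiStar_insert_of_not_harms ξ hLU hi hj h] at hC
  exact Harms.notMem_of_harms hk hFM hik hkj ((subset_insert i L).trans hLC) hCU hjC hC
    (hLC (mem_insert_self i L))

/-- If ξ satisfies Fence Monotonicity at every pair (L',U') with
|U'∖L'| < |U∖L|, then for every j ∈ L there is a set S_j between L and U where all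
players of S_j∖L, and also j, are charged their minimum payment at (L,U). -/
theorem stmt4 (ξ : Fin n → Finset (Fin n) → ℝ) (hξ : IsCostSharingScheme ξ)
    (L U : Finset (Fin n)) (hLU : L ⊆ U)
    (hIH : ∀ L' U' : Finset (Fin n), L' ⊆ U' → (U' \ L').card < (U \ L).card →
      FenceMonoAt ξ L' U')
    (j : Fin n) (hj : j ∈ L) :
    ∃ S : Finset (Fin n), L ⊆ S ∧ S ⊆ U ∧
      (∀ i ∈ S \ L, ξ i S = xiStar ξ L U i) ∧ ξ j S = xiStar ξ L U j := by
  have hFM : ∀ i ∈ U \ L, FenceMonoAt ξ (insert i L) U := fun i hi => by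
    obtain ⟨hiU, hiL⟩ := mem_sdiff.1 hi
    refine hIH _ _ (insert_subset hiU hLU) (card_lt_card ?_)
    refine (sdiff_subset_sdiff subset_rfl (subset_insert i L)).ssubset_of_ne fun h => ?_
    rw [← h] at hi
    simp at hi
  by_cases hall : ∀ i ∈ U \ L, Harms ξ L U i j
  · obtain ⟨S, hLS, hSU, hjS, hS⟩ := exists_eq_xiStar ξ hLU (hLU hj)
    refine ⟨S, hLS, hSU, fun i hi => ?_, hS⟩
    obtain ⟨hiS, hiL⟩ := mem_sdiff.1 hi
    exact absurd hiS ((hall i (mem_sdiff.2 ⟨hSU hiS, hiL⟩)).notMem hLS hSU hjS hS)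
  · push Not at hall
    obtain ⟨i₀, hi₀, h₀⟩ := hall
    let r : Fin n → Fin n → Prop := fun k i => i ∈ U \ L ∧ k ∈ U \ L ∧ Harms ξ L U i k
    have : IsTrans (Fin n) r := ⟨fun a b c hab hbc => ⟨hbc.1, hab.2.1,
      Harms.trans hLU (sdiff_subset hbc.1) (sdiff_subset hab.1) (sdiff_subset hab.2.1)
        (hFM b hab.1) hbc.2.2 hab.2.2⟩⟩
    have : Std.Irrefl r := ⟨fun a h => h.2.2.1 rfl⟩
    obtain ⟨i, ⟨hi, hij⟩, hmin⟩ := (Finite.wellFounded_of_trans_of_irrefl r).has_min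
      {i | i ∈ U \ L ∧ ¬ Harms ξ L U i j} ⟨i₀, hi₀, h₀⟩
    have hiU : i ∈ U := sdiff_subset hi
    have hharm : ∀ k ∈ U \ L, ¬ Harms ξ L U i k := fun k hk hik =>
      hmin k ⟨hk, fun hkj => hij
        (Harms.trans hLU hiU (sdiff_subset hk) (hLU hj) (hFM k hk) hik hkj)⟩ ⟨hi, hk, hik⟩
    obtain ⟨S, hLS, hSU, hS⟩ := (hFM i hi).1
    have hLS' : L ⊆ S := (subset_insert i L).trans hLS
    refine ⟨S, hLS', hSU, fun k hk => ?_, ?_⟩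
    · obtain ⟨hkS, hkL⟩ := mem_sdiff.1 hk
      rw [hS k hkS, xiStar_insert_of_not_harms ξ hLU hiU (hSU hkS)
        (hharm k (mem_sdiff.2 ⟨hSU hkS, hkL⟩))]
    · rw [hS j (hLS' hj), xiStar_insert_of_not_harms ξ hLU hiU (hLU hj) hij]
end

section
/- Let ξ be a cost-sharing scheme and suppose the pair (L,U) is stable at the bid vector b. Then U is the unique maximal set containing L on which all bids cover the minimum payments: every set U′ with L ⊆ U′ ⊆ A satisfying b_i ≥ ξ*(i,L,U′) for all i ∈ U′∖L is a subset of U. -/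
open Finset

variable {n : ℕ}

theorem xiStar_anti_right {ξ : Fin n → Finset (Fin n) → ℝ} (hξ : ∀ i S, 0 ≤ ξ i S)
    {L U V : Finset (Fin n)} (hLU : L ⊆ U) (hUV : U ⊆ V) {i : Fin n} (hi : i ∈ U) :
    xiStar ξ L V i ≤ xiStar ξ L U i := by
  refine csInf_le_csInf ⟨0, ?_⟩ ⟨_, U, hLU, Subset.rfl, hi, rfl⟩ ?_
  · rintro _ ⟨S, -, -, -, rfl⟩
    exact hξ i S
  · rintro _ ⟨S, hLS, hSU, hiS, rfl⟩
    exact ⟨S, hLS, hSU.trans hUV, hiS, rfl⟩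

/-- If (L,U) is stable at b then U is the maximal set containing L on which
all bids cover the minimum payments. -/
theorem stmt18 (ξ : Fin n → Finset (Fin n) → ℝ) (hξ : IsCostSharingScheme ξ)
    (b : Fin n → ℝ) (L U : Finset (Fin n)) (hstable : StablePair ξ b L U)
    (U' : Finset (Fin n)) (hLU' : L ⊆ U')
    (hU' : ∀ i ∈ U' \ L, xiStar ξ L U' i ≤ b i) :
    U' ⊆ U := by
  by_contra h
  obtain ⟨hLU, -, -, hmax⟩ := hstable
  obtain ⟨i, hi, hlt⟩ := hmax (U' \ U) (fun i hi => mem_compl.2 (mem_sdiff.1 hi).2)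
    (sdiff_nonempty.2 h)
  obtain ⟨hiU', hiU⟩ := mem_sdiff.1 hi
  rw [union_sdiff_self_eq_union] at hlt
  have hle := xiStar_anti_right hξ.1 hLU' (subset_union_right : U' ⊆ U ∪ U') hiU'
  have hcover := hU' i (mem_sdiff.2 ⟨hiU', fun hiL => hiU (hLU hiL)⟩)
  exact (hlt.trans_le (hle.trans hcover)).false
end
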